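/- arXiv:2504.18224 — 3 statements merged into one kernel-verified Lean document; each statement's English description precedes it below -/
import Mathlib

section
/- In a weakly reversible ring R, every nilpotent element generates a nilpotent two-sided ideal; consequently the Wedderburn radical, lower nilradical, upper nilradical, and set of nilpotent elements all coincide, i.e., R is 2-primal and Nil(R) equals the lower nilradical. -/
def IsReversibleElem {R : Type*} [Ring R] (a : R) : Prop :=
  ∀ b : R, b * a = 0 ↔ a * b = 0

def WeaklyReversible (R : Type*) [Ring R] : Prop :=
  ∀ a : R, a ≠ 0 → ∃ m : ℕ, 0 < m ∧ a ^ m ≠ 0 ∧ IsReversibleElem (a ^ m)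

/-- A two-sided ideal `P` of a (possibly noncommutative) ring is prime if it is proper
and `xRy ⊆ P` implies `x ∈ P` or `y ∈ P`. -/
def IsPrimeTwoSidedIdeal {R : Type*} [Ring R] (P : TwoSidedIdeal R) : Prop :=
  (P : Set R) ≠ Set.univ ∧ ∀ x y : R, (∀ r : R, x * r * y ∈ P) → x ∈ P ∨ y ∈ P

/-- `IsPowerWord a k t w` says that `w = a ^ i₀ * r₁ * a ^ i₁ * ⋯ * r_k * a ^ i_k` for some ring
elements `r₁, …, r_k` and exponents `i₀, …, i_k` with sum `t`. -/
inductive IsPowerWord {R : Type*} [Ring R] (a : R) : ℕ → ℕ → R → Prop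
  | pow (i : ℕ) : IsPowerWord a 0 i (a ^ i)
  | cons (i : ℕ) (r : R) {k t : ℕ} {w : R} (hw : IsPowerWord a k t w) :
      IsPowerWord a (k + 1) (i + t) (a ^ i * r * w)

namespace IsPowerWord

variable {R : Type*} [Ring R] {a : R}

theorem pow_mul (i : ℕ) {k t : ℕ} {w : R} (hw : IsPowerWord a k t w) :
    IsPowerWord a k (i + t) (a ^ i * w) := by
  cases hw with
  | pow j => rw [← pow_add]; exact .pow _
  | cons j r hw =>
    rw [← add_assoc, ← mul_assoc, ← mul_assoc, ← pow_add]
    exact .cons _ _ hw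

theorem mul {k l s t : ℕ} {v w : R} (hv : IsPowerWord a k s v) (hw : IsPowerWord a l t w) :
    IsPowerWord a (k + l) (s + t) (v * w) := by
  induction hv with
  | pow i => rw [zero_add]; exact hw.pow_mul i
  | cons i r _ ih =>
    rw [mul_assoc, Nat.add_right_comm, Nat.add_assoc i]
    exact .cons i r ih

theorem mul_mul (r : R) {k l s t : ℕ} {v w : R} (hv : IsPowerWord a k s v)
    (hw : IsPowerWord a l t w) : IsPowerWord a (k + l + 1) (s + t) (v * r * w) := by
  have h := hv.mul (.cons 0 r hw)
  rw [zero_add, pow_zero, one_mul, ← mul_assoc] at h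
  exact h

theorem exists_split (p q : ℕ) {t : ℕ} {w : R} (hw : IsPowerWord a (p + q + 1) t w) :
    ∃ (s s' : ℕ) (u r v : R), IsPowerWord a p s u ∧ IsPowerWord a q s' v ∧
      t = s + s' ∧ w = u * r * v := by
  induction p generalizing t w with
  | zero =>
    rw [zero_add] at hw
    cases hw with
    | cons i r hw => exact ⟨_, _, _, _, _, .pow i, hw, rfl, rfl⟩
  | succ p ih =>
    rw [add_right_comm p 1 q] at hw
    cases hw with
    | cons i r hw =>
      obtain ⟨s, s', u, r', v, hu, hv, rfl, rfl⟩ := ih hw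
      exact ⟨_, _, _, r', v, .cons i r hu, hv, (add_assoc _ _ _).symm, by simp only [mul_assoc]⟩

theorem exists_notMem {P : TwoSidedIdeal R} (hP : IsPrimeTwoSidedIdeal P) (ha : a ∉ P) (n : ℕ) :
    ∃ k w, IsPowerWord a k n w ∧ w ∉ P := by
  induction n with
  | zero =>
    refine ⟨0, a ^ 0, .pow 0, fun h => hP.1 (Set.eq_univ_of_forall fun x => ?_)⟩
    rw [pow_zero] at h
    simpa using P.mul_mem_left x 1 h
  | succ n ih =>
    obtain ⟨k, w, hw, hwP⟩ := ih
    by_contra! H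
    refine (hP.2 a w fun r => ?_).elim ha hwP
    have h := H _ _ (add_comm 1 n ▸ IsPowerWord.cons 1 r hw)
    rwa [pow_one] at h

theorem exists_prod_ofFn_eq (n : ℕ) (r s : Fin n → R) :
    ∃ k x w y, IsPowerWord a k n w ∧ (List.ofFn fun i => r i * a * s i).prod = x * w * y := by
  induction n with
  | zero => exact ⟨0, 1, a ^ 0, 1, .pow 0, by simp⟩
  | succ n ih =>
    obtain ⟨k, x, w, y, hw, h⟩ := ih (fun i => r i.succ) (fun i => s i.succ)
    refine ⟨k + 1, r 0, a ^ 1 * (s 0 * x) * w, y, add_comm 1 n ▸ IsPowerWord.cons 1 _ hw, ?_⟩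
    rw [List.ofFn_succ, List.prod_cons, h, pow_one]
    simp only [mul_assoc]

end IsPowerWord

namespace WeaklyReversible

variable {R : Type*} [Ring R]

theorem isReversibleElem_of_mul_self (hR : WeaklyReversible R) {x : R} (hx : x * x = 0) :
    IsReversibleElem x := by
  rcases eq_or_ne x 0 with rfl | h0
  · intro b; simp
  · obtain ⟨m, hm, hne, hrev⟩ := hR x h0
    obtain rfl : m = 1 := by
      by_contra h
      exact hne (pow_eq_zero_of_le (by omega : 2 ≤ m) (by rw [sq, hx]))
    rwa [pow_one] at hrev

theorem mul_mul_eq_zero_of_right (hR : WeaklyReversible R) {u v : R} (r : R) (hv : v * v = 0)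
    (hvu : v * u = 0) : u * r * v = 0 :=
  (hR.isReversibleElem_of_mul_self hv _).2 (by rw [← mul_assoc, hvu, zero_mul])

theorem mul_mul_eq_zero_of_left (hR : WeaklyReversible R) {u v : R} (r : R) (hu : u * u = 0)
    (hvu : v * u = 0) : u * r * v = 0 := by
  rw [mul_assoc]
  exact (hR.isReversibleElem_of_mul_self hu _).1 (by rw [mul_assoc, hvu, mul_zero])

theorem eq_zero_of_isPowerWord (hR : WeaklyReversible R) {a : R} {n : ℕ} (ha : a ^ n = 0)
    {k t : ℕ} {w : R} (hw : IsPowerWord a k t w) (ht : n ≤ t) : w = 0 := by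
  induction k using Nat.strong_induction_on generalizing t w with
  | _ k ih =>
    rcases Nat.even_or_odd' k with ⟨q, rfl | rfl⟩
    · rcases q with _ | q
      · cases hw with
        | pow i => exact pow_eq_zero_of_le ht ha
      · rw [show 2 * (q + 1) = q + (0 + q + 1) + 1 by ring] at hw
        obtain ⟨s, _, u, r, _, hu, hbv, rfl, rfl⟩ := hw.exists_split
        obtain ⟨i, s', b, r', v, hb, hv, rfl, rfl⟩ := hbv.exists_split
        rcases le_total s s' with h | h
        · refine hR.mul_mul_eq_zero_of_right r ?_ ?_
          · have h0 := ih _ (by omega) ((hv.mul hb).mul_mul r' hv) (by omega)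
            calc b * r' * v * (b * r' * v) = b * r' * (v * b * r' * v) := by
                  simp only [mul_assoc]
              _ = 0 := by rw [h0, mul_zero]
          · exact ih _ (by omega) ((hb.mul_mul r' hv).mul hu) (by omega)
        · have h0 : u * r * b * (u * r * b) = 0 := by
            have h0 := ih _ (by omega) (hu.mul_mul r (hb.mul hu)) (by omega)
            calc u * r * b * (u * r * b) = u * r * (b * u) * (r * b) := by
                  simp only [mul_assoc]
              _ = 0 := by rw [h0, zero_mul]
          have h1 := hR.mul_mul_eq_zero_of_left r' h0
            (ih _ (by omega) (hv.mul (hu.mul_mul r hb)) (by omega))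
          simpa only [mul_assoc] using h1
    · rw [two_mul] at hw
      obtain ⟨s, s', u, r, v, hu, hv, rfl, rfl⟩ := hw.exists_split
      have hvu := ih _ (by omega) (hv.mul hu) (by omega)
      rcases le_total s s' with h | h
      · exact hR.mul_mul_eq_zero_of_right r (ih _ (by omega) (hv.mul hv) (by omega)) hvu
      · exact hR.mul_mul_eq_zero_of_left r (ih _ (by omega) (hu.mul hu) (by omega)) hvu

end WeaklyReversible

theorem TwoSidedIdeal.exists_maximal_pow_notMem {R : Type*} [Ring R] {a : R}
    (ha : ¬ IsNilpotent a) :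
    ∃ P : TwoSidedIdeal R, Maximal (fun I : TwoSidedIdeal R => ∀ n : ℕ, a ^ n ∉ I) P := by
  obtain ⟨P, -, hP⟩ := zorn_le_nonempty₀ {I : TwoSidedIdeal R | ∀ n : ℕ, a ^ n ∉ I} (by
    intro c hc hchain I₀ hI₀
    have hdir : ∀ {x y : R}, (∃ I ∈ c, x ∈ I) → (∃ I ∈ c, y ∈ I) → ∃ I ∈ c, x ∈ I ∧ y ∈ I := by
      rintro x y ⟨I, hI, hx⟩ ⟨J, hJ, hy⟩
      rcases hchain.total hI hJ with h | h
      · exact ⟨J, hJ, h hx, hy⟩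
      · exact ⟨I, hI, hx, h hy⟩
    refine ⟨.mk' {x | ∃ I ∈ c, x ∈ I} ⟨I₀, hI₀, I₀.zero_mem⟩ ?_ ?_ ?_ ?_, ?_, ?_⟩
    · intro x y hx hy
      obtain ⟨I, hI, hx, hy⟩ := hdir hx hy
      exact ⟨I, hI, I.add_mem hx hy⟩
    · rintro x ⟨I, hI, hx⟩
      exact ⟨I, hI, I.neg_mem hx⟩
    · rintro x y ⟨I, hI, hy⟩
      exact ⟨I, hI, I.mul_mem_left _ _ hy⟩
    · rintro x y ⟨I, hI, hx⟩
      exact ⟨I, hI, I.mul_mem_right _ _ hx⟩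
    · intro n hn
      rw [TwoSidedIdeal.mem_mk'] at hn
      obtain ⟨I, hI, hx⟩ := hn
      exact hc hI n hx
    · intro I hI x hx
      rw [TwoSidedIdeal.mem_mk']
      exact ⟨I, hI, hx⟩) ⊥ (by
    intro n hn
    exact ha ⟨n, by simpa using hn⟩)
  exact ⟨P, hP⟩

/-- The two-sided ideal of all `z` with `z * R * y ⊆ P`. -/
def TwoSidedIdeal.leftTransporter {R : Type*} [Ring R] (P : TwoSidedIdeal R) (y : R) :
    TwoSidedIdeal R :=
  .mk' {z | ∀ r, z * r * y ∈ P} (fun r => by simp [P.zero_mem])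
    (fun hx hy r => by simpa only [add_mul] using P.add_mem (hx r) (hy r))
    (fun hx r => by simpa only [neg_mul] using P.neg_mem (hx r))
    (fun {x _} hy r => by simpa only [mul_assoc] using P.mul_mem_left x _ (hy r))
    (fun {_ y} hx r => by simpa only [mul_assoc] using hx (y * r))

/-- The two-sided ideal of all `z` with `x * R * z ⊆ P`. -/
def TwoSidedIdeal.rightTransporter {R : Type*} [Ring R] (P : TwoSidedIdeal R) (x : R) :
    TwoSidedIdeal R :=
  .mk' {z | ∀ r, x * r * z ∈ P} (fun r => by simp [P.zero_mem])
    (fun hx hy r => by simpa only [mul_add] using P.add_mem (hx r) (hy r))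
    (fun hx r => by simpa only [mul_neg] using P.neg_mem (hx r))
    (fun {x _} hy r => by simpa only [mul_assoc] using hy (r * x))
    (fun {_ y} hx r => by simpa only [mul_assoc] using P.mul_mem_right _ y (hx r))

theorem TwoSidedIdeal.mem_leftTransporter {R : Type*} [Ring R] {P : TwoSidedIdeal R} {y z : R} :
    z ∈ P.leftTransporter y ↔ ∀ r, z * r * y ∈ P :=
  TwoSidedIdeal.mem_mk' ..

theorem TwoSidedIdeal.mem_rightTransporter {R : Type*} [Ring R] {P : TwoSidedIdeal R} {x z : R} :
    z ∈ P.rightTransporter x ↔ ∀ r, x * r * z ∈ P :=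
  TwoSidedIdeal.mem_mk' ..

theorem isPrimeTwoSidedIdeal_of_maximal_pow_notMem {R : Type*} [Ring R] {a : R}
    {P : TwoSidedIdeal R}
    (hP : Maximal (fun I : TwoSidedIdeal R => ∀ n : ℕ, a ^ n ∉ I) P) :
    IsPrimeTwoSidedIdeal P := by
  have key : ∀ {I : TwoSidedIdeal R} {x : R}, P ≤ I → x ∈ I → x ∉ P → ∃ n : ℕ, a ^ n ∈ I := by
    intro I x hle hxI hxP
    by_contra! H
    exact hxP (hP.le_of_ge H hle hxI)
  refine ⟨fun h => hP.prop 0 (Set.eq_univ_iff_forall.1 h _), fun x y hxy => ?_⟩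
  by_contra! H
  obtain ⟨i, hi⟩ := key (I := P.leftTransporter y)
    (fun z hz => TwoSidedIdeal.mem_leftTransporter.2 fun r =>
      P.mul_mem_right _ _ (P.mul_mem_right _ _ hz))
    (TwoSidedIdeal.mem_leftTransporter.2 hxy) H.1
  obtain ⟨j, hj⟩ := key (I := P.rightTransporter (a ^ i))
    (fun z hz => TwoSidedIdeal.mem_rightTransporter.2 fun r => P.mul_mem_left _ _ hz)
    (TwoSidedIdeal.mem_rightTransporter.2 (TwoSidedIdeal.mem_leftTransporter.1 hi)) H.2
  refine hP.prop (i + j) ?_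
  simpa only [mul_one, pow_add] using TwoSidedIdeal.mem_rightTransporter.1 hj 1

theorem isNilpotent_of_forall_mem_prime {R : Type*} [Ring R] {a : R}
    (h : ∀ P : TwoSidedIdeal R, IsPrimeTwoSidedIdeal P → a ∈ P) : IsNilpotent a := by
  by_contra ha
  obtain ⟨P, hP⟩ := TwoSidedIdeal.exists_maximal_pow_notMem ha
  exact hP.prop 1 (by simpa using h P (isPrimeTwoSidedIdeal_of_maximal_pow_notMem hP))

/-- In a weakly reversible ring: every nilpotent element generates a nilpotent two-sided
ideal (`(RaR)ⁿ = 0` for some `n`), and consequently the set of nilpotent elements equals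
the lower nilradical (the intersection of all prime two-sided ideals), i.e. `R` is
2-primal. -/
theorem stmt_11 {R : Type*} [Ring R] (hR : WeaklyReversible R) :
    (∀ a : R, IsNilpotent a → ∃ n : ℕ, 0 < n ∧
      ∀ r s : Fin n → R, (List.ofFn fun i => r i * a * s i).prod = 0) ∧
    (∀ a : R, IsNilpotent a ↔ ∀ P : TwoSidedIdeal R, IsPrimeTwoSidedIdeal P → a ∈ P) := by
  refine ⟨?_, fun a => ⟨?_, isNilpotent_of_forall_mem_prime⟩⟩
  · rintro a ⟨n, hn⟩
    refine ⟨n + 1, n.succ_pos, fun r s => ?_⟩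
    obtain ⟨k, x, w, y, hw, h⟩ := IsPowerWord.exists_prod_ofFn_eq (a := a) (n + 1) r s
    rw [h, hR.eq_zero_of_isPowerWord hn hw n.le_succ, mul_zero, zero_mul]
  · rintro ⟨n, hn⟩ P hP
    by_contra haP
    obtain ⟨k, w, hw, hwP⟩ := IsPowerWord.exists_notMem hP haP n
    exact hwP (hR.eq_zero_of_isPowerWord hn hw le_rfl ▸ P.zero_mem)
end

section
/- If R is a weakly reversible ring, then R/Nil(R) is a reduced ring. -/
section WeaklyReversible

variable {R : Type*} [Ring R]

theorem WeaklyReversible.isReversibleElem_of_mul_self_eq_zero (hR : WeaklyReversible R) {w : R}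
    (hw : w * w = 0) : IsReversibleElem w := by
  by_cases h0 : w = 0
  · intro b
    simp [h0]
  obtain ⟨m, hm, hne, hrev⟩ := hR w h0
  obtain rfl | hm2 : m = 1 ∨ 2 ≤ m := by omega
  · simpa using hrev
  · exact absurd (pow_eq_zero_of_le hm2 (by rw [pow_two, hw])) hne

/-- A non-nilpotent element has reversible powers with arbitrarily large exponent. -/
theorem WeaklyReversible.exists_le_isReversibleElem_pow (hR : WeaklyReversible R) {c : R}
    (hc : ¬ IsNilpotent c) (N : ℕ) : ∃ m, N ≤ m ∧ IsReversibleElem (c ^ m) := by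
  obtain ⟨m, hm, -, hrev⟩ := hR (c ^ (N + 1)) fun h => hc ⟨_, h⟩
  refine ⟨(N + 1) * m, by nlinarith, ?_⟩
  rwa [pow_mul]

theorem pow_mul_eq_zero_of_exponent_le {c x : R} {N M : ℕ} (h : c ^ N * x = 0) (hNM : N ≤ M) :
    c ^ M * x = 0 := by
  rw [← Nat.sub_add_cancel hNM, pow_add, mul_assoc, h, mul_zero]

theorem mul_pow_eq_zero_of_exponent_le {c x : R} {N M : ℕ} (h : x * c ^ N = 0) (hNM : N ≤ M) :
    x * c ^ M = 0 := by
  rw [← Nat.add_sub_cancel' hNM, pow_add, ← mul_assoc, h, zero_mul]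

theorem WeaklyReversible.isNilpotent_mul_right (hR : WeaklyReversible R) {a : R}
    (ha : IsNilpotent a) (r : R) : IsNilpotent (a * r) := by
  by_contra hc
  obtain ⟨n, hn⟩ := ha
  have key : ∀ i, (∃ N, a ^ i * (a * r) ^ N = 0) → ∃ N, (a * r) ^ N = 0 := by
    intro i
    induction i with
    | zero => simp
    | succ i ih =>
      rintro ⟨N, hN⟩
      apply ih
      obtain ⟨M, hNM, hM⟩ := hR.exists_le_isReversibleElem_pow hc N
      have h1 := (hM _).1 (mul_pow_eq_zero_of_exponent_le hN hNM)
      have h2 : (a * r) ^ M * (a ^ i * (a * r)) = 0 := by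
        rw [← mul_assoc (a ^ i), ← pow_succ, ← mul_assoc, h1, zero_mul]
      refine ⟨M + 1, ?_⟩
      rw [pow_succ', ← mul_assoc]
      exact (hM _).2 h2
  exact hc (key n ⟨0, by simp [hn]⟩)

theorem isNilpotent_mul_swap {a r : R} (h : IsNilpotent (a * r)) : IsNilpotent (r * a) := by
  obtain ⟨n, hn⟩ := h
  have hpow : ∀ k : ℕ, (r * a) ^ (k + 1) = r * (a * r) ^ k * a := by
    intro k
    induction k with
    | zero => simp
    | succ k ih => rw [pow_succ, ih, pow_succ (a * r)]; simp only [mul_assoc]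
  exact ⟨n + 1, by rw [hpow, hn, mul_zero, zero_mul]⟩

theorem WeaklyReversible.isNilpotent_mul_left (hR : WeaklyReversible R) {a : R}
    (ha : IsNilpotent a) (r : R) : IsNilpotent (r * a) :=
  isNilpotent_mul_swap (hR.isNilpotent_mul_right ha r)

/-- The annihilator of a reversible element `w` is a two-sided ideal; if it contains `b`, then
`a + b` and `a` agree modulo it. -/
theorem IsReversibleElem.add_pow_mul_eq_zero {w a b : R} (hw : IsReversibleElem w)
    (hb : b * w = 0) {k : ℕ} (hk : a ^ k = 0) : (a + b) ^ k * w = 0 := by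
  have key : ∀ j : ℕ, (a + b) ^ j * w = a ^ j * w := by
    intro j
    induction j with
    | zero => simp
    | succ j ih =>
      have h : b * a ^ j * w = 0 := by
        rw [hw, ← mul_assoc, (hw b).1 hb, zero_mul]
      rw [pow_succ', mul_assoc, ih, add_mul, ← mul_assoc b, h, add_zero, ← mul_assoc, ← pow_succ']
  rw [key, hk, zero_mul]

theorem IsReversibleElem.pow_add_self_mul_eq_zero {c y : R} {M : ℕ} (h : IsReversibleElem (c ^ M))
    (hy : c ^ M * (y * c ^ M) = 0) : c ^ (M + M) * y = 0 := by
  rw [pow_add, mul_assoc]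
  exact (h _).1 (by rwa [mul_assoc])

theorem WeaklyReversible.exists_add_pow_mul_eq_zero_of_sq (hR : WeaklyReversible R) {a b y : R}
    (ha : IsNilpotent a) (hc : ¬ IsNilpotent (a + b)) (hby : b * y = 0)
    (hy : ∃ N, (a + b) ^ N * y ^ 2 = 0) : ∃ N, (a + b) ^ N * y = 0 := by
  obtain ⟨k, hk⟩ := ha
  obtain ⟨N, hN⟩ := hy
  obtain ⟨M, hle, hM⟩ := hR.exists_le_isReversibleElem_pow hc (max N k)
  have kill : ∀ x, (y * x) * (y * x) = 0 → (a + b) ^ M * (y * x) = 0 := by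
    intro x hx
    have hbx : b * (y * x) = 0 := by rw [← mul_assoc, hby, zero_mul]
    exact pow_mul_eq_zero_of_exponent_le ((hR.isReversibleElem_of_mul_self_eq_zero hx).add_pow_mul_eq_zero
      hbx hk) (le_trans (le_max_right _ _) hle)
  have hyy : (a + b) ^ M * (y * y) = 0 := by
    rw [← pow_two]
    exact pow_mul_eq_zero_of_exponent_le hN (le_trans (le_max_left _ _) hle)
  have hz := kill ((a + b) ^ M * y) <| by
    calc y * ((a + b) ^ M * y) * (y * ((a + b) ^ M * y))
        = y * ((a + b) ^ M * (y * y)) * ((a + b) ^ M * y) := by simp only [mul_assoc]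
      _ = 0 := by rw [hyy, mul_zero, zero_mul]
  have hw := kill ((a + b) ^ M) <| by
    have := (hM _).2 hz
    simpa only [mul_assoc] using this
  exact ⟨M + M, hM.pow_add_self_mul_eq_zero hw⟩

theorem WeaklyReversible.exists_add_pow_mul_eq_zero (hR : WeaklyReversible R) {a b y : R}
    (ha : IsNilpotent a) (hc : ¬ IsNilpotent (a + b)) (hby : b * y = 0)
    (hy : IsNilpotent y) : ∃ N, (a + b) ^ N * y = 0 := by
  have key : ∀ (j : ℕ) (y : R), b * y = 0 → y ^ 2 ^ j = 0 → ∃ N, (a + b) ^ N * y = 0 := by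
    intro j
    induction j with
    | zero =>
      intro y _ h
      exact ⟨0, by simpa using h⟩
    | succ j ih =>
      intro y hby h
      refine hR.exists_add_pow_mul_eq_zero_of_sq ha hc hby (ih (y ^ 2) ?_ ?_)
      · rw [pow_two, ← mul_assoc, hby, zero_mul]
      · rwa [← pow_mul, ← pow_succ']
  obtain ⟨n, hn⟩ := hy
  exact key n y hby (pow_eq_zero_of_le Nat.lt_two_pow_self.le hn)

theorem WeaklyReversible.isNilpotent_add (hR : WeaklyReversible R) {a b : R}
    (ha : IsNilpotent a) (hb : IsNilpotent b) : IsNilpotent (a + b) := by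
  by_contra hc
  have key : ∀ j, (∃ N, (a + b) ^ N * b ^ (j + 1) = 0) → ∃ N, (a + b) ^ N * b = 0 := by
    intro j
    induction j with
    | zero => simp
    | succ j ih =>
      rintro ⟨N, hN⟩
      apply ih
      obtain ⟨M, hNM, hM⟩ := hR.exists_le_isReversibleElem_pow hc N
      have h1 : b * (b ^ (j + 1) * (a + b) ^ M) = 0 := by
        rw [← mul_assoc, ← pow_succ']
        exact (hM _).2 (pow_mul_eq_zero_of_exponent_le hN hNM)
      obtain ⟨K, hK⟩ := hR.exists_add_pow_mul_eq_zero ha hc h1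
        (hR.isNilpotent_mul_right (hb.pow_succ j) _)
      obtain ⟨L, hL, hrev⟩ := hR.exists_le_isReversibleElem_pow hc (max K M)
      refine ⟨L + L, hrev.pow_add_self_mul_eq_zero ?_⟩
      rw [← mul_assoc] at hK ⊢
      refine mul_pow_eq_zero_of_exponent_le ?_ (le_trans (le_max_right _ _) hL)
      rw [mul_assoc] at hK ⊢
      exact pow_mul_eq_zero_of_exponent_le hK (le_trans (le_max_left _ _) hL)
  obtain ⟨l, hl⟩ := hb
  obtain ⟨N, hN⟩ := key l ⟨0, by rw [pow_succ, hl, zero_mul, mul_zero]⟩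
  obtain ⟨M, hNM, hM⟩ := hR.exists_le_isReversibleElem_pow hc N
  obtain ⟨k, hk⟩ := ha
  have h := hM.add_pow_mul_eq_zero ((hM _).2 (pow_mul_eq_zero_of_exponent_le hN hNM)) hk
  exact hc ⟨k + M, by rw [pow_add, h]⟩

end WeaklyReversible

/-- If `R` is weakly reversible, then the nilpotent elements form a two-sided ideal
and the quotient `R / Nil(R)` is a reduced ring. -/
theorem stmt_13 {R : Type*} [Ring R] (hR : WeaklyReversible R) :
    ∃ I : TwoSidedIdeal R, (∀ a : R, a ∈ I ↔ IsNilpotent a) ∧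
      IsReduced I.ringCon.Quotient := by
  let I : TwoSidedIdeal R := TwoSidedIdeal.mk' {a | IsNilpotent a} IsNilpotent.zero
    (fun ha hb => hR.isNilpotent_add ha hb) (fun ha => ha.neg)
    (fun hb => hR.isNilpotent_mul_left hb _) (fun ha => hR.isNilpotent_mul_right ha _)
  have hI : ∀ a : R, a ∈ I ↔ IsNilpotent a := fun a => TwoSidedIdeal.mem_mk' ..
  refine ⟨I, hI, ⟨fun x => ?_⟩⟩
  obtain ⟨a, rfl⟩ := I.ringCon.mk'_surjective x
  rintro ⟨n, hn⟩
  have mk_eq_zero : ∀ b : R, I.ringCon.mk' b = 0 ↔ IsNilpotent b := fun b => by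
    rw [← hI, TwoSidedIdeal.mem_iff, ← map_zero I.ringCon.mk']
    exact RingCon.eq _
  rw [← map_pow, mk_eq_zero] at hn
  obtain ⟨m, hm⟩ := hn
  exact (mk_eq_zero a).2 ⟨n * m, by rw [pow_mul, hm]⟩
end

section
/- Let R be a weakly reversible ring. Then the polynomial ring R[x] is strongly right AB and strongly left AB: for every subset X ⊆ R[x], if the right (resp. left) annihilator of X in R[x] is nonzero, then it contains a nonzero two-sided ideal of R[x]. -/
open Polynomial in
/-- If multiplying by `g` on the right kills the leading coefficient of every left annihilator
of `g`, then it kills all coefficients of every left annihilator of `g`. -/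
theorem C_coeff_mul_eq_zero_of_leadingCoeff {R : Type*} [Ring R] {g : R[X]}
    (h : ∀ f : R[X], f * g = 0 → C f.leadingCoeff * g = 0) (f : R[X]) (hf : f * g = 0) (i : ℕ) :
    C (f.coeff i) * g = 0 := by
  induction hn : f.support.card using Nat.strong_induction_on generalizing f with
  | _ n ih =>
    by_cases hf0 : f = 0
    · simp [hf0]
    have hl := h f hf
    have he : f.eraseLead * g = 0 := by
      have hX : C f.leadingCoeff * X ^ f.natDegree * g = 0 := by
        rw [← X_pow_mul, mul_assoc, hl, mul_zero]
      rw [← f.eraseLead_add_C_mul_X_pow, add_mul, hX, add_zero] at hf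
      exact hf
    by_cases hi : i = f.natDegree
    · rw [hi]
      exact hl
    · have := ih _ (hn ▸ eraseLead_support_card_lt hf0) f.eraseLead he rfl
      rwa [eraseLead_coeff_of_ne i hi] at this

theorem IsReversibleElem.mul_mul_eq_zero {R : Type*} [Ring R] {a b : R}
    (ha : IsReversibleElem a) (h : b * a = 0) (r : R) : b * r * a = 0 := by
  rw [ha, ← mul_assoc, (ha b).1 h, zero_mul]

theorem WeaklyReversible.isReversibleElem_of_mul_self_s17 {R : Type*} [Ring R]
    (hR : WeaklyReversible R) {a : R} (ha : a * a = 0) : IsReversibleElem a := by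
  by_cases h0 : a = 0
  · intro b
    simp [h0]
  obtain ⟨m, hm, hne, hrev⟩ := hR a h0
  obtain rfl | h2 : m = 1 ∨ 2 ≤ m := by omega
  · simpa using hrev
  · exact absurd (pow_eq_zero_of_le h2 (by rw [sq, ha])) hne

theorem WeaklyReversible.op {R : Type*} [Ring R] (hR : WeaklyReversible R) :
    WeaklyReversible Rᵐᵒᵖ := by
  intro a ha
  obtain ⟨m, hm, hne, hrev⟩ := hR a.unop (by simpa using ha)
  refine ⟨m, hm, fun h => hne ?_, fun b => ?_⟩
  · rw [← MulOpposite.unop_pow, h, MulOpposite.unop_zero]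
  · rw [← MulOpposite.unop_eq_zero_iff, ← MulOpposite.unop_eq_zero_iff (a ^ m * b)]
    simpa using (hrev b.unop).symm

open Polynomial in
/-- A polynomial of least degree in a right annihilator is killed by everything that kills
its leading coefficient. -/
theorem mul_C_eq_zero_of_minimal_natDegree {R : Type*} [Ring R] {X : Set R[X]} {g : R[X]}
    (hg : ∀ f ∈ X, f * g = 0)
    (hmin : ∀ h : R[X], h ≠ 0 → (∀ f ∈ X, f * h = 0) → g.natDegree ≤ h.natDegree)
    {a : R} (ha : g.leadingCoeff * a = 0) : g * C a = 0 := by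
  by_contra hne
  have hle := hmin _ hne fun f hf => by rw [← mul_assoc, hg f hf, zero_mul]
  have hdeg := le_antisymm (natDegree_mul_C_le g a) hle
  apply hne
  rw [← leadingCoeff_eq_zero, leadingCoeff, hdeg, coeff_mul_C]
  exact ha

open Polynomial in
theorem WeaklyReversible.exists_isReversibleElem_coeff_mul_eq_zero {R : Type*} [Ring R]
    (hR : WeaklyReversible R) (X : Set R[X]) (hX : ∃ g : R[X], g ≠ 0 ∧ ∀ f ∈ X, f * g = 0) :
    ∃ c : R, c ≠ 0 ∧ IsReversibleElem c ∧ ∀ f ∈ X, ∀ i, f.coeff i * c = 0 := by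
  obtain ⟨g₀, ⟨hg₀, hXg₀⟩, hmin₀⟩ := (measure (natDegree (R := R))).wf.has_min
    {g : R[X] | g ≠ 0 ∧ ∀ f ∈ X, f * g = 0} hX
  replace hmin₀ : ∀ h : R[X], h ≠ 0 → (∀ f ∈ X, f * h = 0) → g₀.natDegree ≤ h.natDegree :=
    fun h h0 h1 => not_lt.1 (hmin₀ h ⟨h0, h1⟩)
  -- Multiplying on the right keeps the degree minimal unless it kills the leading coefficient.
  have key : ∀ a : R, g₀.leadingCoeff * a ≠ 0 → ∃ g : R[X], (∀ f ∈ X, f * g = 0) ∧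
      (∀ h : R[X], h ≠ 0 → (∀ f ∈ X, f * h = 0) → g.natDegree ≤ h.natDegree) ∧
      g.leadingCoeff = g₀.leadingCoeff * a := by
    intro a ha
    have hd : (g₀ * C a).natDegree = g₀.natDegree := natDegree_mul_C_eq_of_mul_ne_zero ha
    refine ⟨g₀ * C a, fun f hf => by rw [← mul_assoc, hXg₀ f hf, zero_mul], ?_, ?_⟩
    · rwa [hd]
    · rw [leadingCoeff, hd, coeff_mul_C]
      rfl
  by_cases hsq : ∃ a, g₀.leadingCoeff * a ≠ 0 ∧
      g₀.leadingCoeff * a * (g₀.leadingCoeff * a) = 0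
  · obtain ⟨a, ha, ha2⟩ := hsq
    obtain ⟨g, hXg, hmin, hlead⟩ := key a ha
    rw [← hlead] at ha ha2
    have hc := hR.isReversibleElem_of_mul_self_s17 ha2
    have hrev : ∀ j, IsReversibleElem (g.coeff j) := by
      intro j
      have h1 : g.coeff j * g.leadingCoeff = 0 := by
        rw [← coeff_mul_C, mul_C_eq_zero_of_minimal_natDegree hXg hmin ha2, coeff_zero]
      have h2 := mul_C_eq_zero_of_minimal_natDegree hXg hmin ((hc _).1 h1)
      apply hR.isReversibleElem_of_mul_self_s17
      rw [← coeff_mul_C, h2, coeff_zero]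
    refine ⟨_, ha, hc, fun f hf i => ?_⟩
    have h := C_coeff_mul_eq_zero_of_leadingCoeff (g := g) (fun f hf => ?_) f (hXg f hf) i
    · rw [leadingCoeff, ← coeff_C_mul, h, coeff_zero]
    · have h1 : f.leadingCoeff * g.leadingCoeff = 0 := by
        rw [← coeff_mul_degree_add_degree, hf, coeff_zero]
      have h2 := mul_C_eq_zero_of_minimal_natDegree hXg hmin ((hc _).1 h1)
      ext j
      rw [coeff_C_mul, coeff_zero, hrev j, ← coeff_mul_C, h2, coeff_zero]
  · push Not at hsq
    obtain ⟨m, hm, hne, hc⟩ := hR g₀.leadingCoeff (leadingCoeff_ne_zero.2 hg₀)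
    obtain ⟨k, rfl⟩ : ∃ k, m = k + 1 := ⟨m - 1, by omega⟩
    rw [pow_succ'] at hne hc
    obtain ⟨g, hXg, -, hlead⟩ := key _ hne
    rw [← hlead] at hne hc
    have hred : ∀ b, b * g.leadingCoeff * g.leadingCoeff = 0 → b * g.leadingCoeff = 0 := by
      intro b hb
      rw [hc]
      by_contra hcb
      rw [hc, ← mul_assoc] at hb
      refine hsq (g₀.leadingCoeff ^ k * b) ?_ ?_
      · rwa [← mul_assoc, ← hlead]
      · rw [← mul_assoc g₀.leadingCoeff, ← hlead, ← mul_assoc, hb, zero_mul]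
    refine ⟨_, hne, hc, fun f hf i => hred _ ?_⟩
    have h := C_coeff_mul_eq_zero_of_leadingCoeff (g := g * C g.leadingCoeff)
      (fun f hf => ?_) f (by rw [← mul_assoc, hXg f hf, zero_mul]) i
    · have := congrArg (coeff · g.natDegree) h
      rwa [coeff_C_mul, coeff_mul_C, coeff_zero, ← mul_assoc] at this
    · have h1 : f.leadingCoeff * g.leadingCoeff = 0 := by
        apply hred
        have := coeff_mul_add_eq_of_natDegree_le le_rfl
          (natDegree_mul_C_le g g.leadingCoeff) (f := f)
        rw [hf, coeff_zero, coeff_mul_C, ← mul_assoc] at this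
        exact this.symm
      ext j
      rw [coeff_C_mul, coeff_mul_C, ← mul_assoc, hc.mul_mul_eq_zero h1, coeff_zero]

/-- If `R` is weakly reversible, then `R[x]` is strongly right AB and strongly left AB:
any nonzero right (resp. left) annihilator of a subset of `R[x]` contains a nonzero
two-sided ideal of `R[x]`. -/
theorem stmt_17 {R : Type*} [Ring R] (hR : WeaklyReversible R) :
    (∀ X : Set (Polynomial R), (∃ g : Polynomial R, g ≠ 0 ∧ ∀ f ∈ X, f * g = 0) →
      ∃ I : TwoSidedIdeal (Polynomial R), I ≠ ⊥ ∧ ∀ g ∈ I, ∀ f ∈ X, f * g = 0) ∧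
    (∀ X : Set (Polynomial R), (∃ g : Polynomial R, g ≠ 0 ∧ ∀ f ∈ X, g * f = 0) →
      ∃ I : TwoSidedIdeal (Polynomial R), I ≠ ⊥ ∧ ∀ g ∈ I, ∀ f ∈ X, g * f = 0) := by
  refine ⟨fun X hX => ?_, fun X hX => ?_⟩
  · obtain ⟨c, hc0, hc, hXc⟩ := hR.exists_isReversibleElem_coeff_mul_eq_zero X hX
    let I : TwoSidedIdeal (Polynomial R) := .mk' {p | ∀ f ∈ X, ∀ h, f * h * p = 0}
      (by simp)
      (fun hx hy f hf h => by rw [mul_add, hx f hf, hy f hf, add_zero])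
      (fun hx f hf h => by rw [mul_neg, hx f hf, neg_zero])
      (fun {x y} hy f hf h => by rw [← mul_assoc, mul_assoc f, hy f hf])
      (fun {x y} hx f hf h => by rw [← mul_assoc, hx f hf, zero_mul])
    have mem_I (p) : p ∈ I ↔ ∀ f ∈ X, ∀ h, f * h * p = 0 := by
      simp [I, TwoSidedIdeal.mem_mk']
    refine ⟨I, fun hI => ?_, fun g hg f hf => by simpa using (mem_I g).1 hg f hf 1⟩
    have hcI : Polynomial.C c ∈ I := by
      rw [mem_I]
      intro f hf h
      ext n
      rw [Polynomial.coeff_mul_C, Polynomial.coeff_mul, Finset.sum_mul, Polynomial.coeff_zero]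
      exact Finset.sum_eq_zero fun i _ => hc.mul_mul_eq_zero (hXc f hf _) _
    rw [hI, TwoSidedIdeal.mem_bot, Polynomial.C_eq_zero] at hcI
    exact hc0 hcI
  · obtain ⟨g, hg0, hg⟩ := hX
    let e := Polynomial.opRingEquiv R
    obtain ⟨c, hc0, hc, hXc⟩ := hR.op.exists_isReversibleElem_coeff_mul_eq_zero
      ((fun f => e (.op f)) '' X) ⟨e (.op g), by simpa using hg0, by
        rintro _ ⟨f, hf, rfl⟩
        rw [← map_mul, ← MulOpposite.op_mul, hg f hf, MulOpposite.op_zero, map_zero]⟩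
    have hXc' : ∀ f ∈ X, ∀ i, f.coeff i * c.unop = 0 := by
      intro f hf i
      have := (hc _).1 (hXc _ ⟨f, hf, rfl⟩ i)
      simpa [e] using congrArg MulOpposite.unop this
    have hcu : ∀ b : R, b * c.unop = 0 → c.unop * b = 0 := by
      intro b hb
      have := (hc (.op b)).2 (by rw [← MulOpposite.unop_eq_zero_iff]; simpa using hb)
      simpa using congrArg MulOpposite.unop this
    let I : TwoSidedIdeal (Polynomial R) := .mk' {p | ∀ f ∈ X, ∀ h, p * (h * f) = 0}
      (by simp)
      (fun hx hy f hf h => by rw [add_mul, hx f hf, hy f hf, add_zero])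
      (fun hx f hf h => by rw [neg_mul, hx f hf, neg_zero])
      (fun {x y} hy f hf h => by rw [mul_assoc, hy f hf, mul_zero])
      (fun {x y} hx f hf h => by rw [mul_assoc, ← mul_assoc y, hx f hf])
    have mem_I (p) : p ∈ I ↔ ∀ f ∈ X, ∀ h, p * (h * f) = 0 := by
      simp [I, TwoSidedIdeal.mem_mk']
    refine ⟨I, fun hI => ?_, fun g hg f hf => by simpa using (mem_I g).1 hg f hf 1⟩
    have hcI : Polynomial.C c.unop ∈ I := by
      rw [mem_I]
      intro f hf h
      ext n
      rw [Polynomial.coeff_C_mul, Polynomial.coeff_mul, Finset.mul_sum, Polynomial.coeff_zero]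
      refine Finset.sum_eq_zero fun i _ => hcu _ ?_
      rw [mul_assoc, hXc' f hf, mul_zero]
    rw [hI, TwoSidedIdeal.mem_bot, Polynomial.C_eq_zero] at hcI
    exact hc0 (by simpa using hcI)
end
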